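/- Let a : ℝ → ℝ and b, c : ℝ × ℝ × ℝ → ℝ be smooth (ContDiff ℝ ⊤), and let p₀ = (t₀, x₀, u₀) ∈ ℝ³ with a(t₀) ≠ 0. Then there exist an open set Ω ⊆ ℝ³ containing p₀ and smooth functions T : ℝ → ℝ and X, U : ℝ × ℝ × ℝ → ℝ such that: (1) the map Φ(t,x,u) = (T(t), X(t,x,u), U(t,x,u)) is injective on Ω and its total derivative (fderiv) is a linear isomorphism at every point of Ω; (2) a(t)·T'(t) = 1 for every (t,x,u) ∈ Ω; and (3) a·∂X/∂t + b·∂X/∂x + c·∂X/∂u = 0 and a·∂U/∂t + b·∂U/∂x + c·∂U/∂u = 0 at every point of Ω. -/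

import Mathlib

open Set Filter Topology
open scoped ContDiff

noncomputable def bilC (K E F : Type) [TopologicalSpace K] [CompactSpace K]
    [NormedAddCommGroup E] [NormedSpace ℝ E] [NormedAddCommGroup F] [NormedSpace ℝ F] :
    C(K, E →L[ℝ] F) →L[ℝ] C(K, E) →L[ℝ] C(K, F) :=
  LinearMap.mkContinuous₂
    (LinearMap.mk₂ ℝ (fun (A : C(K, E →L[ℝ] F)) (h : C(K, E)) =>
        (⟨fun k => A k (h k), A.continuous.clm_apply h.continuous⟩ : C(K, F)))
      (by intros; ext; simp) (by intros; ext; simp) (by intros; ext; simp) (by intros; ext; simp)) 1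
    (by
      intro A h
      rw [ContinuousMap.norm_le _ (by positivity)]
      intro k
      simp only [LinearMap.mk₂_apply, ContinuousMap.coe_mk, one_mul]
      exact (A k).le_opNorm_of_le (h.norm_coe_le_norm k) |>.trans
        (by gcongr; exact A.norm_coe_le_norm k))

theorem bilC_apply {K E F : Type} [TopologicalSpace K] [CompactSpace K]
    [NormedAddCommGroup E] [NormedSpace ℝ E] [NormedAddCommGroup F] [NormedSpace ℝ F]
    (A : C(K, E →L[ℝ] F)) (h : C(K, E)) (k : K) : bilC K E F A h k = A k (h k) := rfl

theorem omega_hasFDerivAt {K E F : Type} [TopologicalSpace K] [CompactSpace K]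
    [NormedAddCommGroup E] [NormedSpace ℝ E] [NormedAddCommGroup F] [NormedSpace ℝ F]
    (f : E → F) (hf : Differentiable ℝ f) (hf' : Continuous (fderiv ℝ f)) (γ : C(K, E)) :
    HasFDerivAt (fun γ : C(K, E) => (ContinuousMap.mk f hf.continuous).comp γ)
      (bilC K E F ((ContinuousMap.mk (fderiv ℝ f) hf').comp γ)) γ := by
  rw [hasFDerivAt_iff_isLittleO_nhds_zero, Asymptotics.isLittleO_iff]
  intro ε hε
  have hc : IsCompact (range γ) := isCompact_range γ.continuous
  have := hc.uniformContinuousAt_of_continuousAt (fderiv ℝ f) (fun _ _ => hf'.continuousAt)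
    (Metric.dist_mem_uniformity hε)
  obtain ⟨δ, hδ, H⟩ := Metric.mem_uniformity_dist.1 this
  filter_upwards [Metric.ball_mem_nhds (0 : C(K, E)) hδ] with h hh
  rw [ContinuousMap.norm_le _ (by positivity)]
  intro k
  simp only [ContinuousMap.sub_apply, ContinuousMap.comp_apply, ContinuousMap.coe_mk,
    ContinuousMap.add_apply, bilC_apply]
  have hhk : ‖h k‖ < δ := (h.norm_coe_le_norm k).trans_lt (by simpa using hh)
  have key := (convex_ball (γ k) δ).norm_image_sub_le_of_norm_fderiv_le' (𝕜 := ℝ) (f := f)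
    (φ := fderiv ℝ f (γ k)) (C := ε) (fun x _ => hf x)
    (fun x hx => by
      have := H (a := γ k) (b := x) (by rwa [dist_comm]) ⟨k, rfl⟩
      have : dist (fderiv ℝ f (γ k)) (fderiv ℝ f x) < ε := this
      rw [dist_comm, dist_eq_norm] at this
      exact this.le) (Metric.mem_ball_self hδ) (y := γ k + h k) (by simpa using hhk)
  simp only [add_sub_cancel_left] at key
  exact key.trans (by gcongr; exact h.norm_coe_le_norm k)

theorem omega_contDiff_nat {K E : Type} [TopologicalSpace K] [CompactSpace K]
    [NormedAddCommGroup E] [NormedSpace ℝ E] (n : ℕ) :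
    ∀ {F : Type} [NormedAddCommGroup F] [NormedSpace ℝ F] (f : E → F) (hc : Continuous f),
      ContDiff ℝ n f → ContDiff ℝ n (fun γ : C(K, E) => (ContinuousMap.mk f hc).comp γ) := by
  induction n with
  | zero =>
    intro F _ _ f hc hf
    rw [Nat.cast_zero, contDiff_zero]
    exact ContinuousMap.continuous_postcomp _
  | succ n ih =>
    intro F _ _ f hc hf
    have h1 : ContDiff ℝ n (fderiv ℝ f) := by
      apply hf.fderiv_right; norm_cast
    have hd : Differentiable ℝ f := hf.differentiable (by simp)
    have hB := ContinuousLinearMap.contDiff (𝕜 := ℝ) (E := C(K, E →L[ℝ] F))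
      (F := C(K, E) →L[ℝ] C(K, F)) (n := n) (bilC K E F)
    have := ih (fderiv ℝ f) h1.continuous h1
    rw [Nat.cast_succ, contDiff_succ_iff_hasFDerivAt]
    exact ⟨fun γ => bilC K E F ((ContinuousMap.mk (fderiv ℝ f) h1.continuous).comp γ),
      ContDiff.comp (g := fun A => bilC K E F A) hB this, fun γ => omega_hasFDerivAt f hd h1.continuous γ⟩

theorem omega_contDiff {K E F : Type} [TopologicalSpace K] [CompactSpace K]
    [NormedAddCommGroup E] [NormedSpace ℝ E] [NormedAddCommGroup F] [NormedSpace ℝ F]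
    (f : E → F) (hf : ContDiff ℝ ∞ f) :
    ContDiff ℝ ∞ (fun γ : C(K, E) => (ContinuousMap.mk f hf.continuous).comp γ) :=
  contDiff_infty.2 fun n => omega_contDiff_nat n f hf.continuous (contDiff_infty.1 hf n)

theorem inv_lemma {E F : Type} [NormedAddCommGroup E] [NormedSpace ℝ E] [CompleteSpace E]
    [NormedAddCommGroup F] [NormedSpace ℝ F] (f : E → F) (s : Set E) (hs : IsOpen s)
    (hf : ContDiffOn ℝ ∞ f s) (x : E) (hx : x ∈ s) (f' : E ≃L[ℝ] F)
    (hf' : HasFDerivAt f (f' : E →L[ℝ] F) x) :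
    ∃ e : OpenPartialHomeomorph E F, (e : E → F) = f ∧ x ∈ e.source ∧ e.source ⊆ s ∧
      ContDiffOn ℝ ∞ e.symm e.target ∧
      ∀ y ∈ e.source, ∃ A : E ≃L[ℝ] F, HasFDerivAt f (A : E →L[ℝ] F) y := by
  have hat : ∀ y ∈ s, ContDiffAt ℝ ∞ f y := fun y hy => hf.contDiffAt (hs.mem_nhds hy)
  let e₀ := (hat x hx).toOpenPartialHomeomorph f hf' (by simp)
  have hcont : ContinuousOn (fderiv ℝ f) s := hf.continuousOn_fderiv_of_isOpen hs (by simp)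
  let V : Set E := s ∩ (fderiv ℝ f) ⁻¹' (range ((↑) : (E ≃L[ℝ] F) → E →L[ℝ] F))
  have hV : IsOpen V := hcont.isOpen_inter_preimage hs ContinuousLinearEquiv.isOpen
  have hxV : x ∈ V := ⟨hx, ⟨f', hf'.fderiv.symm⟩⟩
  have hA : ∀ y ∈ V, ∃ A : E ≃L[ℝ] F, HasFDerivAt f (A : E →L[ℝ] F) y := by
    rintro y ⟨hy, A, hA⟩
    exact ⟨A, by rw [hA]; exact ((hat y hy).differentiableAt (by simp)).hasFDerivAt⟩
  refine ⟨e₀.restrOpen V hV, rfl, ⟨(hat x hx).mem_toOpenPartialHomeomorph_source hf' (by simp), hxV⟩,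
    fun y hy => hy.2.1, ?_, fun y hy => hA y hy.2⟩
  intro z hz
  have h1 := (e₀.restrOpen V hV).map_target hz
  obtain ⟨A, hA'⟩ := hA _ h1.2
  exact ((e₀.restrOpen V hV).contDiffAt_symm hz hA' (hat _ h1.2.1)).contDiffWithinAt

theorem globalize {E F : Type} [NormedAddCommGroup E] [NormedSpace ℝ E] [FiniteDimensional ℝ E]
    [NormedAddCommGroup F] [NormedSpace ℝ F] (f : E → F) (s : Set E) (hs : IsOpen s)
    (hf : ContDiffOn ℝ ∞ f s) (x : E) (hx : x ∈ s) :
    ∃ g : E → F, ContDiff ℝ ∞ g ∧ g =ᶠ[𝓝 x] f := by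
  obtain ⟨r, hr, hrs⟩ := Metric.nhds_basis_closedBall.mem_iff.1 (hs.mem_nhds hx)
  let φ : ContDiffBump x := ⟨r / 2, r, by positivity, by linarith⟩
  refine ⟨fun y => φ y • f y, ?_, ?_⟩
  · rw [contDiff_iff_contDiffAt]
    intro y
    by_cases hy : y ∈ Metric.closedBall x r
    · exact φ.contDiff.contDiffAt.smul (hf.contDiffAt (hs.mem_nhds (hrs hy)))
    · have : (fun y => φ y • f y) =ᶠ[𝓝 y] fun _ => 0 := by
        filter_upwards [Metric.isClosed_closedBall.isOpen_compl.mem_nhds hy] with z hz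
        rw [φ.zero_of_le_dist, zero_smul]
        have : r < dist z x := by simpa using hz
        exact this.le
      exact contDiffAt_const.congr_of_eventuallyEq this
  · filter_upwards [φ.eventuallyEq_one] with y hy
    simp [hy]

noncomputable def primC (E : Type) [NormedAddCommGroup E] [NormedSpace ℝ E] :
    C(unitInterval, E) →L[ℝ] C(unitInterval, E) :=
  LinearMap.mkContinuous
    { toFun := fun γ => ⟨fun s => ∫ σ in (0:ℝ)..s, γ (projIcc 0 1 zero_le_one σ),
        (intervalIntegral.continuous_primitive (fun a b =>
          (γ.continuous.comp continuous_projIcc).intervalIntegrable a b) 0).comp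
            continuous_subtype_val⟩
      map_add' := by
        intro γ η
        ext s
        simp only [ContinuousMap.add_apply, ContinuousMap.coe_mk]
        exact intervalIntegral.integral_add
          ((γ.continuous.comp continuous_projIcc).intervalIntegrable _ _)
          ((η.continuous.comp continuous_projIcc).intervalIntegrable _ _)
      map_smul' := by
        intro c γ
        ext s
        simp } 1
    (by
      intro γ
      rw [ContinuousMap.norm_le _ (by positivity)]
      intro s
      simp only [LinearMap.coe_mk, AddHom.coe_mk, ContinuousMap.coe_mk, one_mul]
      refine (intervalIntegral.norm_integral_le_of_norm_le_const (C := ‖γ‖)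
        (fun σ _ => γ.norm_coe_le_norm _)).trans ?_
      rw [sub_zero, abs_of_nonneg s.2.1]
      exact mul_le_of_le_one_right (norm_nonneg _) s.2.2)

theorem primC_apply {E : Type} [NormedAddCommGroup E] [NormedSpace ℝ E]
    (γ : C(unitInterval, E)) (s : unitInterval) :
    primC E γ s = ∫ σ in (0:ℝ)..s, γ (projIcc 0 1 zero_le_one σ) := rfl

noncomputable def constC (E : Type) [NormedAddCommGroup E] [NormedSpace ℝ E] :
    E →L[ℝ] C(unitInterval, E) := ContinuousLinearMap.const ℝ unitInterval

noncomputable def shearC {E C : Type} [NormedAddCommGroup E] [NormedSpace ℝ E]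
    [NormedAddCommGroup C] [NormedSpace ℝ C] (k : E →L[ℝ] C) (v : C) :
    (ℝ × E × C) ≃L[ℝ] (ℝ × E × C) :=
  ContinuousLinearEquiv.equivOfInverse
    ((ContinuousLinearMap.fst ℝ ℝ (E × C)).prod
      (((ContinuousLinearMap.fst ℝ E C).comp (ContinuousLinearMap.snd ℝ ℝ (E × C))).prod
        ((ContinuousLinearMap.snd ℝ E C).comp (ContinuousLinearMap.snd ℝ ℝ (E × C))
          - k.comp ((ContinuousLinearMap.fst ℝ E C).comp (ContinuousLinearMap.snd ℝ ℝ (E × C)))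
          - (ContinuousLinearMap.fst ℝ ℝ (E × C)).smulRight v)))
    ((ContinuousLinearMap.fst ℝ ℝ (E × C)).prod
      (((ContinuousLinearMap.fst ℝ E C).comp (ContinuousLinearMap.snd ℝ ℝ (E × C))).prod
        ((ContinuousLinearMap.snd ℝ E C).comp (ContinuousLinearMap.snd ℝ ℝ (E × C))
          + k.comp ((ContinuousLinearMap.fst ℝ E C).comp (ContinuousLinearMap.snd ℝ ℝ (E × C)))
          + (ContinuousLinearMap.fst ℝ ℝ (E × C)).smulRight v)))
    (by rintro ⟨t, x, g⟩; simp; abel) (by rintro ⟨t, x, g⟩; simp; abel)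

theorem flow_lemma {E : Type} [NormedAddCommGroup E] [NormedSpace ℝ E] [CompleteSpace E]
    (f : E → E) (hf : ContDiff ℝ ∞ f) (x₀ : E) :
    ∃ (α : E × ℝ → E) (s : Set (E × ℝ)), IsOpen s ∧ (x₀, (0:ℝ)) ∈ s ∧ ContDiffOn ℝ ∞ α s ∧
      (∀ x t, (x, t) ∈ s → HasDerivAt (fun τ => α (x, τ)) (f (α (x, t))) t) ∧
      (∀ x t, (x, t) ∈ s → α (x, 0) = x) := by
  have hf1 : ContDiffAt ℝ 1 f x₀ := (hf.of_le (by simp)).contDiffAt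
  obtain ⟨ε, hε, A, r, L, K, hr, hpl⟩ := IsPicardLindelof.of_contDiffAt_one hf1
  obtain ⟨α, hα, hαc⟩ :=
    (hpl 0).exists_forall_mem_closedBall_eq_hasDerivWithinAt_continuousOn
  simp only [zero_sub, zero_add] at hα hαc
  let om : C(unitInterval, E) → C(unitInterval, E) := fun γ => (ContinuousMap.mk f hf.continuous).comp γ
  have hom : ContDiff ℝ ∞ om := omega_contDiff f hf
  let G : ℝ × E × C(unitInterval, E) → ℝ × E × C(unitInterval, E) := fun q =>
    (q.1, q.2.1, q.2.2 - constC E q.2.1 - q.1 • primC E (om q.2.2))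
  have hP : ContDiff ℝ ∞ (fun q : ℝ × E × C(unitInterval, E) => primC E (om q.2.2)) :=
    (primC E).contDiff.comp (hom.comp (contDiff_snd.comp contDiff_snd))
  have hG : ContDiff ℝ ∞ G := by
    refine contDiff_fst.prodMk ((contDiff_fst.comp contDiff_snd).prodMk ?_)
    refine ((contDiff_snd.comp contDiff_snd).sub
      ((constC E).contDiff.comp (contDiff_fst.comp contDiff_snd))).sub ?_
    exact contDiff_fst.smul hP
  let q₀ : ℝ × E × C(unitInterval, E) := (0, x₀, constC E x₀)
  have hG' : HasFDerivAt G
      (shearC (constC E) (primC E (om (constC E x₀))) : (ℝ × E × C(unitInterval, E)) →L[ℝ] (ℝ × E × C(unitInterval, E))) q₀ := by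
    have h1 : HasFDerivAt (fun q : ℝ × E × C(unitInterval, E) => q.1)
      (ContinuousLinearMap.fst ℝ ℝ (E × C(unitInterval, E))) q₀ := hasFDerivAt_fst
    have h2 : HasFDerivAt (fun q : ℝ × E × C(unitInterval, E) => q.2)
      (ContinuousLinearMap.snd ℝ ℝ (E × C(unitInterval, E))) q₀ := hasFDerivAt_snd
    have h3 := h2.fst
    have h4 := h2.snd
    have h5 := (constC E).hasFDerivAt.comp q₀ h3
    have h6 := h1.smul ((hP.differentiable (by simp)) q₀).hasFDerivAt
    have h7 := h1.prodMk (h3.prodMk ((h4.sub h5).sub h6))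
    refine h7.congr_fderiv ?_
    ext q <;> simp [shearC, q₀]
  obtain ⟨e, he, hq₀, -, hes, -⟩ := inv_lemma G univ isOpen_univ hG.contDiffOn q₀ (mem_univ _)
    _ hG'
  obtain ⟨δ, hδ, hball⟩ := Metric.isOpen_iff.1 e.open_source q₀ hq₀
  -- closeness
  have hx₀ : x₀ ∈ Metric.closedBall x₀ r := Metric.mem_closedBall_self r.2
  have hcl : ∀ᶠ p in 𝓝 (x₀, (0:ℝ)), dist (α p) x₀ < δ / 2 := by
    have hc : ContinuousAt α (x₀, 0) := hαc.continuousAt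
      (prod_mem_nhds (Metric.closedBall_mem_nhds _ hr) (Icc_mem_nhds (by linarith) hε))
    have := hc.eventually (Metric.ball_mem_nhds _ (half_pos hδ))
    rwa [(hα x₀ hx₀).1] at this
  obtain ⟨η, hη, hcl⟩ := Metric.eventually_nhds_iff_ball.1 hcl
  let ρ : ℝ := min (min η (δ / 2)) (min ε r)
  have hρ : 0 < ρ := by
    have : (0:ℝ) < r := hr
    simp only [ρ, lt_min_iff]; exact ⟨⟨hη, half_pos hδ⟩, hε, this⟩
  have hρη : ρ ≤ η := (min_le_left _ _).trans (min_le_left _ _)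
  have hρδ : ρ ≤ δ / 2 := (min_le_left _ _).trans (min_le_right _ _)
  have hρε : ρ ≤ ε := (min_le_right _ _).trans (min_le_left _ _)
  have hρr : ρ ≤ r := (min_le_right _ _).trans (min_le_right _ _)
  let s : Set (E × ℝ) := Metric.ball (x₀, 0) ρ
  have hs : ∀ x t, (x, t) ∈ s ↔ dist x x₀ < ρ ∧ |t| < ρ := by
    intro x t
    simp [s, Prod.dist_eq]
  have hder : ∀ x t, (x, t) ∈ s → HasDerivAt (fun τ => α (x, τ)) (f (α (x, t))) t := by
    intro x t h
    obtain ⟨h1, h2⟩ := (hs x t).1 h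
    have h3 := abs_lt.1 h2
    exact ((hα x (Metric.mem_closedBall.2 (h1.le.trans hρr))).2 t
      ⟨by linarith, by linarith⟩).hasDerivAt (Icc_mem_nhds (by linarith) (by linarith))
  have hinit : ∀ x t, (x, t) ∈ s → α (x, 0) = x := by
    intro x t h
    exact (hα x (Metric.mem_closedBall.2 (((hs x t).1 h).1.le.trans hρr))).1
  have hscale : ∀ x t, (x, t) ∈ s → ∀ σ ∈ Icc (0:ℝ) 1, (x, t * σ) ∈ s := by
    intro x t h σ hσ
    obtain ⟨h1, h2⟩ := (hs x t).1 h
    refine (hs _ _).2 ⟨h1, ?_⟩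
    rw [abs_mul, abs_of_nonneg hσ.1]
    exact (mul_le_of_le_one_right (abs_nonneg _) hσ.2).trans_lt h2
  have key : ∀ p ∈ s, (p.2, p.1, (0 : C(unitInterval, E))) ∈ e.target ∧
      α p = (e.symm (p.2, p.1, 0)).2.2 1 := by
    rintro ⟨x, t⟩ h
    obtain ⟨h1, h2⟩ := (hs x t).1 h
    let γ : C(unitInterval, E) := ⟨fun σ => α (x, t * σ), by
      rw [continuous_iff_continuousAt]
      intro σ
      have := (hder x _ (hscale x t h σ σ.2)).continuousAt
      exact ContinuousAt.comp (f := fun σ : unitInterval => t * (σ:ℝ)) this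
        (by fun_prop)⟩
    have hmem : (t, x, γ) ∈ e.source := by
      apply hball
      have hγ : dist γ (constC E x₀) ≤ δ / 2 := by
        rw [ContinuousMap.dist_le (by positivity)]
        intro σ
        exact (hcl _ (Metric.ball_subset_ball hρη (hscale x t h σ σ.2))).le
      simp only [q₀, Metric.mem_ball, Prod.dist_eq, max_lt_iff]
      refine ⟨?_, by linarith, by linarith⟩
      rw [Real.dist_eq, sub_zero]; linarith
    have hGe : e (t, x, γ) = (t, x, 0) := by
      rw [he]
      simp only [G, Prod.mk.injEq, true_and]
      ext σ
      simp only [ContinuousMap.sub_apply, ContinuousMap.smul_apply, primC_apply,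
        ContinuousMap.zero_apply]
      have hint : ∫ τ in (0:ℝ)..σ, t • f (α (x, t * τ)) = α (x, t * σ) - α (x, t * 0) := by
        have hsub : uIcc (0:ℝ) σ ⊆ Icc 0 1 := by
          rw [uIcc_of_le σ.2.1]; exact Icc_subset_Icc_right σ.2.2
        have hd : ∀ τ ∈ Icc (0:ℝ) 1,
            HasDerivAt (fun τ => α (x, t * τ)) (t • f (α (x, t * τ))) τ := by
          intro τ hτ
          have h5 := hder x _ (hscale x t h τ hτ)
          have h6 : HasDerivAt (fun τ : ℝ => t * τ) t τ := by
            simpa using (hasDerivAt_id τ).const_mul t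
          exact h5.scomp τ h6
        apply intervalIntegral.integral_eq_sub_of_hasDerivAt (f := fun τ => α (x, t * τ))
          (fun τ hτ => hd τ (hsub hτ))
        apply ContinuousOn.intervalIntegrable
        intro τ hτ
        exact ((hf.continuous.continuousAt.comp (hd τ (hsub hτ)).continuousAt).const_smul
          t).continuousWithinAt
      have hcongr : ∫ τ in (0:ℝ)..σ, om γ (projIcc 0 1 zero_le_one τ)
          = ∫ τ in (0:ℝ)..σ, f (α (x, t * τ)) := by
        apply intervalIntegral.integral_congr
        intro τ hτ
        rw [uIcc_of_le σ.2.1] at hτ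
        have : τ ∈ Icc (0:ℝ) 1 := ⟨hτ.1, hτ.2.trans σ.2.2⟩
        simp only [om, γ, ContinuousMap.comp_apply, ContinuousMap.coe_mk]
        rw [projIcc_of_mem _ this]
      rw [hcongr, ← intervalIntegral.integral_smul, hint, mul_zero, hinit x t h]
      simp [γ, constC]
    have h7 := e.map_source hmem
    rw [hGe] at h7
    refine ⟨h7, ?_⟩
    have h8 := e.left_inv hmem
    rw [hGe] at h8
    simp only [h8]
    simp [γ]
  refine ⟨α, s, Metric.isOpen_ball, Metric.mem_ball_self hρ, ?_, hder, hinit⟩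
  have h9 : ContDiffOn ℝ ∞ (fun p : E × ℝ => (e.symm (p.2, p.1, 0)).2.2 1) s := by
    have h10 : ContDiffOn ℝ ∞ (fun p : E × ℝ => e.symm (p.2, p.1, 0)) s :=
      hes.comp (t := e.target) (s := s) (f := fun p : E × ℝ => (p.2, p.1, (0 : C(unitInterval, E))))
        (contDiff_snd.prodMk (contDiff_fst.prodMk contDiff_const)).contDiffOn
        (fun p hp => (key p hp).1)
    exact (ContinuousMap.evalCLM ℝ (1 : unitInterval)).contDiff.comp_contDiffOn
      (contDiff_snd.comp_contDiffOn (contDiff_snd.comp_contDiffOn h10))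
  exact h9.congr fun p hp => (key p hp).2

theorem local_straightening_of_vector_field
    (a : ℝ → ℝ) (b c : ℝ × ℝ × ℝ → ℝ)
    (ha : ContDiff ℝ (⊤ : ℕ∞) a) (hb : ContDiff ℝ (⊤ : ℕ∞) b) (hc : ContDiff ℝ (⊤ : ℕ∞) c)
    (t₀ x₀ u₀ : ℝ) (ha0 : a t₀ ≠ 0) :
    ∃ (Ω : Set (ℝ × ℝ × ℝ)) (T : ℝ → ℝ) (X U : ℝ × ℝ × ℝ → ℝ),
      IsOpen Ω ∧ (t₀, x₀, u₀) ∈ Ω ∧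
      ContDiff ℝ (⊤ : ℕ∞) T ∧ ContDiff ℝ (⊤ : ℕ∞) X ∧ ContDiff ℝ (⊤ : ℕ∞) U ∧
      Set.InjOn (fun p : ℝ × ℝ × ℝ => (T p.1, X p, U p)) Ω ∧
      (∀ p ∈ Ω, Function.Bijective
        (fderiv ℝ (fun p : ℝ × ℝ × ℝ => (T p.1, X p, U p)) p)) ∧
      (∀ p ∈ Ω, a p.1 * deriv T p.1 = 1) ∧
      (∀ p ∈ Ω, a p.1 * fderiv ℝ X p (1, 0, 0) + b p * fderiv ℝ X p (0, 1, 0)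
        + c p * fderiv ℝ X p (0, 0, 1) = 0) ∧
      (∀ p ∈ Ω, a p.1 * fderiv ℝ U p (1, 0, 0) + b p * fderiv ℝ U p (0, 1, 0)
        + c p * fderiv ℝ U p (0, 0, 1) = 0) := by
  let p₀ : ℝ × ℝ × ℝ := (t₀, x₀, u₀)
  let W : ℝ × ℝ × ℝ → ℝ × ℝ × ℝ := fun p => (a p.1, b p, c p)
  have hW : ContDiff ℝ ∞ W := (ha.comp contDiff_fst).prodMk (hb.prodMk hc)
  obtain ⟨α, s, hs, hp₀s, hα, hder, hinit⟩ := flow_lemma W hW p₀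
  -- the function T
  obtain ⟨g, hg, hga⟩ : ∃ g : ℝ → ℝ, ContDiff ℝ ∞ g ∧ g =ᶠ[𝓝 t₀] fun t => (a t)⁻¹ := by
    refine globalize (fun t => (a t)⁻¹) {t | a t ≠ 0} (isOpen_ne_fun ha.continuous
      continuous_const) ?_ t₀ ha0
    exact ha.contDiffOn.inv fun t ht => ht
  let T : ℝ → ℝ := fun t => ∫ τ in t₀..t, g τ
  have hTd : ∀ t, HasDerivAt T (g t) t := fun t => hg.continuous.integral_hasStrictDerivAt t₀ t
    |>.hasDerivAt
  have hT : ContDiff ℝ ∞ T := by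
    rw [contDiff_infty_iff_deriv]
    refine ⟨fun t => (hTd t).differentiableAt, ?_⟩
    have : deriv T = g := funext fun t => (hTd t).deriv
    rwa [this]
  -- the flow chart
  let ι : ℝ × ℝ × ℝ → (ℝ × ℝ × ℝ) × ℝ := fun q => ((t₀, q.2), q.1)
  have hι : ContDiff ℝ ∞ ι := (contDiff_const.prodMk contDiff_snd).prodMk contDiff_fst
  let Ψ : ℝ × ℝ × ℝ → ℝ × ℝ × ℝ := fun q => α (ι q)
  have hs' : IsOpen (ι ⁻¹' s) := hs.preimage hι.continuous
  let q₀ : ℝ × ℝ × ℝ := (0, x₀, u₀)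
  have hq₀ : q₀ ∈ ι ⁻¹' s := hp₀s
  have hΨ : ContDiffOn ℝ ∞ Ψ (ι ⁻¹' s) := hα.comp hι.contDiffOn (fun q hq => hq)
  have hΨd : ∀ q ∈ ι ⁻¹' s, HasFDerivAt Ψ (fderiv ℝ Ψ q) q := fun q hq =>
    ((hΨ.contDiffAt (hs'.mem_nhds hq)).differentiableAt (by simp)).hasFDerivAt
  have hΨt : ∀ q ∈ ι ⁻¹' s, fderiv ℝ Ψ q (1, 0, 0) = W (Ψ q) := by
    intro q hq
    have h1 : HasDerivAt (fun τ : ℝ => (τ, q.2)) (1, 0) q.1 :=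
      (hasDerivAt_id q.1).prodMk (hasDerivAt_const _ _)
    have h2 := (hΨd q hq).comp_hasDerivAt q.1 h1
    have h3 := hder (t₀, q.2) q.1 hq
    exact h2.unique h3
  have hΨ0 : Ψ q₀ = p₀ := hinit p₀ 0 hp₀s
  have hΨy : ∀ w : ℝ × ℝ, fderiv ℝ Ψ q₀ (0, w) = (0, w) := by
    intro w
    have h1 : HasFDerivAt (fun y : ℝ × ℝ => ((0:ℝ), y)) (ContinuousLinearMap.inr ℝ ℝ (ℝ × ℝ))
      (x₀, u₀) := hasFDerivAt_prodMk_right _ _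
    have h2 := (hΨd q₀ hq₀).comp (x₀, u₀) h1
    have h3 : HasFDerivAt (fun y : ℝ × ℝ => (t₀, y)) (ContinuousLinearMap.inr ℝ ℝ (ℝ × ℝ))
      (x₀, u₀) := hasFDerivAt_prodMk_right _ _
    have h4 : (fun y : ℝ × ℝ => (t₀, y)) =ᶠ[𝓝 (x₀, u₀)] (Ψ ∘ fun y : ℝ × ℝ => ((0:ℝ), y)) := by
      have : ContinuousAt (fun y : ℝ × ℝ => ((0:ℝ), y)) (x₀, u₀) := by fun_prop
      filter_upwards [this.preimage_mem_nhds (hs'.mem_nhds hq₀)] with y hy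
      exact (hinit (t₀, y) 0 hy).symm
    have h5 := (h2.congr_of_eventuallyEq h4).unique h3
    have := DFunLike.congr_fun h5 w
    simpa using this
  have hΨq : ∀ w : ℝ × ℝ × ℝ, fderiv ℝ Ψ q₀ w = w.1 • W p₀ + (0, w.2) := by
    rintro ⟨τ, w⟩
    have : ((τ, w) : ℝ × ℝ × ℝ) = τ • ((1, 0, 0) : ℝ × ℝ × ℝ) + (0, w) := by
      ext <;> simp
    rw [this, map_add, map_smul, hΨt q₀ hq₀, hΨy, hΨ0]
    simp
  have hinjΨ : Function.Injective (fderiv ℝ Ψ q₀) := by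
    rw [injective_iff_map_eq_zero]
    rintro ⟨τ, y, z⟩ h
    rw [hΨq] at h
    simp only [W, p₀, Prod.smul_mk, smul_eq_mul, Prod.mk_add_mk, Prod.mk_eq_zero, add_zero] at h
    obtain ⟨h1, h2, h3⟩ := h
    have : τ = 0 := by simpa [ha0] using h1
    subst this
    simp at h2 h3
    simp [h2, h3]
  let DΨ : (ℝ × ℝ × ℝ) ≃L[ℝ] (ℝ × ℝ × ℝ) :=
    (LinearEquiv.ofInjectiveEndo (fderiv ℝ Ψ q₀ : (ℝ × ℝ × ℝ) →ₗ[ℝ] (ℝ × ℝ × ℝ))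
      hinjΨ).toContinuousLinearEquiv
  have hDΨ : (DΨ : (ℝ × ℝ × ℝ) →L[ℝ] (ℝ × ℝ × ℝ)) = fderiv ℝ Ψ q₀ := by
    ext1 <;> rfl
  obtain ⟨e, he, heq₀, hes, hesm, -⟩ := inv_lemma Ψ _ hs' hΨ q₀ hq₀ DΨ
    (by rw [hDΨ]; exact hΨd q₀ hq₀)
  have hp₀t : p₀ ∈ e.target := by
    have := e.map_source heq₀
    rwa [he, hΨ0] at this
  obtain ⟨X, hX, hXe⟩ := globalize (fun p => (e.symm p).2.1) e.target e.open_target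
    (contDiff_fst.comp_contDiffOn (contDiff_snd.comp_contDiffOn hesm)) p₀ hp₀t
  obtain ⟨U, hU, hUe⟩ := globalize (fun p => (e.symm p).2.2) e.target e.open_target
    (contDiff_snd.comp_contDiffOn (contDiff_snd.comp_contDiffOn hesm)) p₀ hp₀t
  -- first integrals
  have gen : ∀ (Y : ℝ × ℝ × ℝ → ℝ) (ℓ : ℝ × ℝ →L[ℝ] ℝ), ContDiff ℝ ∞ Y → ∀ p ∈ e.target,
      Y =ᶠ[𝓝 p] (fun p => ℓ (e.symm p).2) → ∀ w, fderiv ℝ Y p (fderiv ℝ Ψ (e.symm p) w) = ℓ w.2 := by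
    intro Y ℓ hY p hp hYe w
    have hq := e.map_target hp
    have hpe : Ψ (e.symm p) = p := by rw [← he]; exact e.right_inv hp
    have h1 := hΨd _ (hes hq)
    have h2 : HasFDerivAt Y (fderiv ℝ Y p) (Ψ (e.symm p)) := by
      rw [hpe]; exact ((hY.differentiable (by simp)) p).hasFDerivAt
    have h3 := h2.comp _ h1
    have h4 : HasFDerivAt (fun q : ℝ × ℝ × ℝ => ℓ q.2)
      (ℓ.comp (ContinuousLinearMap.snd ℝ ℝ (ℝ × ℝ))) (e.symm p) :=
      ℓ.hasFDerivAt.comp _ hasFDerivAt_snd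
    have h5 : (fun q : ℝ × ℝ × ℝ => ℓ q.2) =ᶠ[𝓝 (e.symm p)] (Y ∘ Ψ) := by
      have hc : Tendsto Ψ (𝓝 (e.symm p)) (𝓝 p) := by
        have := h1.continuousAt.tendsto
        rwa [hpe] at this
      filter_upwards [hc.eventually hYe, e.open_source.mem_nhds hq] with q hq1 hq2
      rw [Function.comp_apply, hq1, ← he, e.left_inv hq2]
    have h6 := (h3.congr_of_eventuallyEq h5).unique h4
    exact DFunLike.congr_fun h6 w
  have genW : ∀ (Y : ℝ × ℝ × ℝ → ℝ) (ℓ : ℝ × ℝ →L[ℝ] ℝ), ContDiff ℝ ∞ Y → ∀ p ∈ e.target,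
      Y =ᶠ[𝓝 p] (fun p => ℓ (e.symm p).2) →
      a p.1 * fderiv ℝ Y p (1, 0, 0) + b p * fderiv ℝ Y p (0, 1, 0)
        + c p * fderiv ℝ Y p (0, 0, 1) = 0 := by
    intro Y ℓ hY p hp hYe
    have h1 := gen Y ℓ hY p hp hYe (1, 0, 0)
    have hpe : Ψ (e.symm p) = p := by rw [← he]; exact e.right_inv hp
    rw [hΨt _ (hes (e.map_target hp)), hpe] at h1
    have : W p = a p.1 • ((1, 0, 0) : ℝ × ℝ × ℝ) + b p • ((0, 1, 0) : ℝ × ℝ × ℝ)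
      + c p • ((0, 0, 1) : ℝ × ℝ × ℝ) := by simp [W]
    rw [this] at h1
    simp only [map_add, map_smul, smul_eq_mul] at h1
    rw [h1]
    exact map_zero ℓ
  let Φ : ℝ × ℝ × ℝ → ℝ × ℝ × ℝ := fun p => (T p.1, X p, U p)
  have hΦ : ContDiff ℝ ∞ Φ := (hT.comp contDiff_fst).prodMk (hX.prodMk hU)
  have hep₀ : e.symm p₀ = q₀ := by
    have := e.left_inv heq₀
    rwa [he, hΨ0] at this
  have hΦd : ∀ p, HasFDerivAt Φ (((ContinuousLinearMap.fst ℝ ℝ (ℝ × ℝ)).smulRight (g p.1)).prod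
      ((fderiv ℝ X p).prod (fderiv ℝ U p))) p := by
    intro p
    have h1 : HasFDerivAt (fun p : ℝ × ℝ × ℝ => T p.1) _ p :=
      (hTd p.1).hasFDerivAt.comp p hasFDerivAt_fst
    have h2 := h1.prodMk (((hX.differentiable (by simp)) p).hasFDerivAt.prodMk
      ((hU.differentiable (by simp)) p).hasFDerivAt)
    refine h2.congr_fderiv ?_
    ext <;> simp
  have hinjΦ : Function.Injective (fderiv ℝ Φ p₀) := by
    rw [injective_iff_map_eq_zero]
    intro v hv
    rw [(hΦd p₀).fderiv] at hv
    obtain ⟨w, rfl⟩ : ∃ w, v = fderiv ℝ Ψ q₀ w :=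
      ⟨DΨ.symm v, by rw [← hDΨ]; exact (DΨ.apply_symm_apply v).symm⟩
    have hx := gen X (ContinuousLinearMap.fst ℝ ℝ ℝ) hX p₀ hp₀t hXe w
    have hu := gen U (ContinuousLinearMap.snd ℝ ℝ ℝ) hU p₀ hp₀t hUe w
    rw [hep₀] at hx hu
    simp only [ContinuousLinearMap.prod_apply, Prod.mk_eq_zero, hx, hu] at hv
    obtain ⟨hv1, hv2, hv3⟩ := hv
    have hw2 : w.2 = 0 := Prod.ext hv2 hv3
    rw [hΨq, hw2] at hv1
    have hg0 : g t₀ = (a t₀)⁻¹ := hga.eq_of_nhds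
    simp [W, p₀, hg0, ha0] at hv1
    have : w = 0 := Prod.ext hv1 hw2
    rw [this, map_zero]
  let DΦ : (ℝ × ℝ × ℝ) ≃L[ℝ] (ℝ × ℝ × ℝ) :=
    (LinearEquiv.ofInjectiveEndo (fderiv ℝ Φ p₀ : (ℝ × ℝ × ℝ) →ₗ[ℝ] (ℝ × ℝ × ℝ))
      hinjΦ).toContinuousLinearEquiv
  have hDΦ : (DΦ : (ℝ × ℝ × ℝ) →L[ℝ] (ℝ × ℝ × ℝ)) = fderiv ℝ Φ p₀ := by
    ext1 <;> rfl
  obtain ⟨e', he', hp₀', -, -, hbij⟩ := inv_lemma Φ univ isOpen_univ hΦ.contDiffOn p₀ (mem_univ _)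
    DΦ (by rw [hDΦ]; exact ((hΦ.differentiable (by simp)) p₀).hasFDerivAt)
  have hgp : ∀ᶠ p : ℝ × ℝ × ℝ in 𝓝 p₀, g p.1 = (a p.1)⁻¹ ∧ a p.1 ≠ 0 :=
    (continuous_fst.tendsto p₀).eventually
      (hga.and (ha.continuous.continuousAt.eventually_ne ha0))
  obtain ⟨Ω, hΩ, hΩo, hΩp⟩ := eventually_nhds_iff.1 (((e'.open_source.eventually_mem hp₀').and
    (e.open_target.eventually_mem hp₀t)).and (hgp.and (hXe.eventuallyEq_nhds.and hUe.eventuallyEq_nhds)))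
  refine ⟨Ω, T, X, U, hΩo, hΩp, hT, hX, hU, ?_, ?_, ?_, ?_, ?_⟩
  · have := e'.injOn
    rw [he'] at this
    exact this.mono fun p hp => (hΩ p hp).1.1
  · intro p hp
    obtain ⟨A, hA⟩ := hbij p (hΩ p hp).1.1
    have : fderiv ℝ Φ p = A := hA.fderiv
    change Function.Bijective (fderiv ℝ Φ p)
    rw [this]
    exact A.bijective
  · intro p hp
    have := (hΩ p hp).2.1
    rw [(hTd p.1).deriv, this.1, mul_inv_cancel₀ this.2]
  · intro p hp
    exact genW X (ContinuousLinearMap.fst ℝ ℝ ℝ) hX p (hΩ p hp).1.2 (hΩ p hp).2.2.1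
  · intro p hp
    exact genW U (ContinuousLinearMap.snd ℝ ℝ ℝ) hU p (hΩ p hp).1.2 (hΩ p hp).2.2.2
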